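/- arXiv:2507.01148 — 4 statements merged into one kernel-verified Lean document; each statement's English description precedes it below -/
import Mathlib

section
/- For every natural number n ≥ 1, the operator norms of A_1^n and A_2^n (with respect to the Euclidean norm on ℝ²) are equal and satisfy ‖A_1^n‖² = (n² + 2 + n√(n² + 4))/2. -/
/-- The parabolic matrix `A₁ = [[1,0],[1,1]]`. -/
def A1 : Matrix (Fin 2) (Fin 2) ℝ := !![1, 0; 1, 1]

/-- The parabolic matrix `A₂ = [[1,1],[0,1]]`. -/
def A2 : Matrix (Fin 2) (Fin 2) ℝ := !![1, 1; 0, 1]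

/-- The operator norm on 2×2 real matrices induced by the Euclidean norm on `ℝ²`. -/
noncomputable def opNorm (M : Matrix (Fin 2) (Fin 2) ℝ) : ℝ :=
  ‖Matrix.toEuclideanCLM (𝕜 := ℝ) M‖

theorem A1_pow (n : ℕ) : A1 ^ n = !![1, 0; (n:ℝ), 1] := by
  induction n with
  | zero => ext i j; fin_cases i <;> fin_cases j <;> simp
  | succ k ih =>
    rw [pow_succ, ih, A1]
    ext i j; fin_cases i <;> fin_cases j <;> simp [Matrix.mul_apply, Fin.sum_univ_two]

theorem A2_pow (n : ℕ) : A2 ^ n = !![1, (n:ℝ); 0, 1] := by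
  induction n with
  | zero => ext i j; fin_cases i <;> fin_cases j <;> simp
  | succ k ih =>
    rw [pow_succ, ih, A2]
    ext i j; fin_cases i <;> fin_cases j <;> simp [Matrix.mul_apply, Fin.sum_univ_two, add_comm]

theorem opNorm_eq_aux (a b c d t : ℝ) (ht : 0 ≤ t)
    (h1 : ∀ x y : ℝ, (a*x+b*y)^2 + (c*x+d*y)^2 ≤ t^2 * (x^2+y^2))
    (u v : ℝ) (huv : 0 < u^2+v^2)
    (h2 : (a*u+b*v)^2 + (c*u+d*v)^2 = t^2 * (u^2+v^2)) :
    opNorm !![a, b; c, d] = t := by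
  have key : ∀ x : EuclideanSpace ℝ (Fin 2),
      ‖Matrix.toEuclideanCLM (𝕜 := ℝ) !![a, b; c, d] x‖ ^ 2
        = (a * x 0 + b * x 1)^2 + (c * x 0 + d * x 1)^2 := by
    intro x
    rw [EuclideanSpace.norm_sq_eq]
    simp [Fin.sum_univ_two, Matrix.ofLp_toEuclideanCLM, Matrix.mulVec, dotProduct]
  have nx : ∀ x : EuclideanSpace ℝ (Fin 2), ‖x‖^2 = x 0 ^2 + x 1 ^2 := by
    intro x
    rw [EuclideanSpace.norm_sq_eq]
    simp [Fin.sum_univ_two]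
  unfold opNorm
  apply le_antisymm
  · refine ContinuousLinearMap.opNorm_le_bound _ ht fun x => ?_
    apply le_of_sq_le_sq _ (by positivity)
    rw [key, mul_pow, nx]
    exact h1 _ _
  · have h := ContinuousLinearMap.le_opNorm
      (Matrix.toEuclideanCLM (𝕜 := ℝ) !![a, b; c, d]) !₂[u, v]
    have h' := pow_le_pow_left₀ (norm_nonneg _) h 2
    rw [key, mul_pow, nx] at h'
    simp only [Matrix.cons_val_zero, Matrix.cons_val_one] at h'
    rw [h2] at h'
    exact le_of_sq_le_sq (le_of_mul_le_mul_right h' huv) (norm_nonneg _)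

/-- For every `n ≥ 1`, `‖A₁^n‖ = ‖A₂^n‖` and
`‖A₁^n‖² = (n² + 2 + n √(n² + 4)) / 2`. -/
theorem stmt4 (n : ℕ) (hn : 1 ≤ n) :
    opNorm (A1 ^ n) = opNorm (A2 ^ n) ∧
      (opNorm (A1 ^ n)) ^ 2
        = ((n : ℝ) ^ 2 + 2 + (n : ℝ) * Real.sqrt ((n : ℝ) ^ 2 + 4)) / 2 := by
  have hs : Real.sqrt ((n : ℝ) ^ 2 + 4) ^ 2 = (n:ℝ)^2 + 4 := Real.sq_sqrt (by positivity)
  have hs0 := Real.sqrt_nonneg ((n : ℝ) ^ 2 + 4)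
  have hm : (0:ℝ) ≤ n := Nat.cast_nonneg n
  rw [A1_pow, A2_pow]
  generalize Real.sqrt ((n : ℝ) ^ 2 + 4) = s at *
  generalize (n : ℝ) = m at *
  have hms : m ≤ s := by nlinarith
  obtain ⟨t, rfl⟩ : ∃ t, s = 2 * t - m := ⟨(s + m) / 2, by ring⟩
  have ht : t ^ 2 = m * t + 1 := by nlinarith
  have ht0 : 0 ≤ t := by linarith
  have hp : ∀ x y : ℝ, t^2 * (x^2+y^2) - (x^2 + (m*x+y)^2) = m * (t-m) * (x-t*y)^2 := by
    intro x y
    linear_combination (x^2 + y^2 + 2*m*x*y - m*t*y^2) * ht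
  have e1 : opNorm !![1, 0; m, 1] = t := by
    refine opNorm_eq_aux 1 0 m 1 t ht0 (fun x y => ?_) t 1 (by positivity) ?_
    · have := hp x y
      have : 0 ≤ m * (t-m) * (x-t*y)^2 :=
        mul_nonneg (mul_nonneg hm (by linarith)) (sq_nonneg _)
      linarith
    · have := hp t 1
      linear_combination -this
  have e2 : opNorm !![1, m; 0, 1] = t := by
    refine opNorm_eq_aux 1 m 0 1 t ht0 (fun x y => ?_) 1 t (by positivity) ?_
    · have := hp y x
      have : 0 ≤ m * (t-m) * (y-t*x)^2 :=
        mul_nonneg (mul_nonneg hm (by linarith)) (sq_nonneg _)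
      linarith
    · have := hp t 1
      linear_combination -this
  rw [e1, e2]
  refine ⟨rfl, ?_⟩
  linear_combination ht
end

section
/- There exists a unique real number t' such that the family ((n + 1/n)^{t'})_{n ∈ ℕ≥1} is summable with ∑_{n=1}^∞ (n + 1/n)^{t'} = 1; moreover t' satisfies −1.83 < t' < −1.82. -/
def Lq : List ℕ := [283220, 188690, 111779, 71834, 49759, 36484, 27922, 22086, 17929, 14863, 12536, 10725, 9288, 8128, 7178, 6388, 5726, 5163, 4682, 4267, 3906, 3590, 3312, 3066, 2847, 2652, 2476, 2318, 2175, 2045, 1927, 1819, 1720, 1629, 1545, 1468, 1397, 1331, 1269, 1212, 1159, 1109, 1063, 1019, 978]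

def Uq : List ℕ := [281265, 186970, 110442, 70803, 48946, 35827, 27379, 21629, 17539, 14525, 12238, 10462, 9054, 7917, 6986, 6214, 5566, 5017, 4547]

noncomputable def ff (t : ℝ) (n : ℕ) : ℝ := (((n + 1 : ℕ) : ℝ) + 1 / ((n + 1 : ℕ) : ℝ)) ^ t

lemma base_ge (n : ℕ) : (1 : ℝ) < ((n + 1 : ℕ) : ℝ) + 1 / ((n + 1 : ℕ) : ℝ) := by
  have h : (1 : ℝ) ≤ ((n + 1 : ℕ) : ℝ) := by exact_mod_cast Nat.succ_le_succ (Nat.zero_le n)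
  have : 0 < 1 / ((n + 1 : ℕ) : ℝ) := by positivity
  linarith

lemma ff_pos (t : ℝ) (n : ℕ) : 0 < ff t n :=
  Real.rpow_pos_of_pos (by linarith [base_ge n]) t

lemma mvt_aux (p : ℝ) (hp : 0 < p) (a : ℝ) (ha : 0 < a) :
    ∃ c, a < c ∧ c < a + 1 ∧ a ^ (-p) / p - (a + 1) ^ (-p) / p = c ^ (-(p + 1)) := by
  obtain ⟨c, hc, h⟩ := exists_hasDerivAt_eq_slope (fun x : ℝ => x ^ (-p) / p)
    (fun x => (-p * x ^ (-p - 1)) / p) (a := a) (b := a + 1) (by linarith)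
    (by
      apply ContinuousOn.div_const
      apply ContinuousOn.rpow_const continuousOn_id
      intro x hx
      left
      have : 0 < x := by linarith [hx.1]
      exact this.ne')
    (by
      intro x hx
      have : 0 < x := by linarith [hx.1]
      exact (Real.hasDerivAt_rpow_const (Or.inl this.ne')).div_const p)
  refine ⟨c, hc.1, hc.2, ?_⟩
  have e : -(p + 1) = -p - 1 := by ring
  rw [e]
  have h2 : -p * c ^ (-p - 1) / p = - c ^ (-p - 1) := by field_simp
  simp only [h2, add_sub_cancel_left, div_one] at h
  linarith

lemma mvt_lo (p : ℝ) (hp : 0 < p) (a : ℝ) (ha : 0 < a) :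
    a ^ (-p) / p - (a + 1) ^ (-p) / p ≤ a ^ (-(p + 1)) := by
  obtain ⟨c, h1, h2, h⟩ := mvt_aux p hp a ha
  rw [h]
  exact Real.rpow_le_rpow_of_nonpos ha h1.le (by linarith)

lemma mvt_hi (p : ℝ) (hp : 0 < p) (a : ℝ) (ha : 0 < a) :
    (a + 1) ^ (-(p + 1)) ≤ a ^ (-p) / p - (a + 1) ^ (-p) / p := by
  obtain ⟨c, h1, h2, h⟩ := mvt_aux p hp a ha
  rw [h]
  exact Real.rpow_le_rpow_of_nonpos (by linarith) h2.le (by linarith)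

lemma pow_aux (x t : ℝ) (hx : 0 < x) (a b : ℕ) (h : t * a = -b) : (x ^ t) ^ a * x ^ b = 1 := by
  rw [← Real.rpow_natCast, ← Real.rpow_mul hx.le, h, Real.rpow_neg hx.le, Real.rpow_natCast]
  exact inv_mul_cancel₀ (by positivity)

lemma lo_aux (x t q : ℝ) (hx : 0 < x) (a b : ℕ) (ha : a ≠ 0) (h : t * a = -b)
    (hq : q ^ a * x ^ b ≤ 1) : q ≤ x ^ t := by
  have h1 := pow_aux x t hx a b h
  rw [← h1] at hq
  exact le_of_pow_le_pow_left₀ ha (Real.rpow_nonneg hx.le t) (le_of_mul_le_mul_right hq (by positivity))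

lemma hi_aux (x t q : ℝ) (hx : 0 < x) (hq0 : 0 ≤ q) (a b : ℕ) (ha : a ≠ 0) (h : t * a = -b)
    (hq : 1 ≤ q ^ a * x ^ b) : x ^ t ≤ q := by
  have h1 := pow_aux x t hx a b h
  rw [← h1] at hq
  exact le_of_pow_le_pow_left₀ ha hq0 (le_of_mul_le_mul_right hq (by positivity))

lemma cast_lo (q m A a b : ℕ) (hm : 0 < m) (hA : 0 < A)
    (h : q ^ a * (m ^ 2 + 1) ^ b ≤ A ^ a * m ^ b) :
    ((q : ℝ) / (A : ℝ)) ^ a * ((m : ℝ) + 1 / (m : ℝ)) ^ b ≤ 1 := by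
  have h' : (q : ℝ) ^ a * ((m : ℝ) ^ 2 + 1) ^ b ≤ (A : ℝ) ^ a * (m : ℝ) ^ b := by
    exact_mod_cast h
  have hm' : (0 : ℝ) < (m : ℝ) := by exact_mod_cast hm
  have hA' : (0 : ℝ) < (A : ℝ) := by exact_mod_cast hA
  have e : (m : ℝ) + 1 / m = ((m : ℝ) ^ 2 + 1) / m := by field_simp
  rw [e, div_pow, div_pow, div_mul_div_comm]
  exact (div_le_one (by positivity)).2 h'

lemma cast_hi (q m A a b : ℕ) (hm : 0 < m) (hA : 0 < A)
    (h : A ^ a * m ^ b ≤ q ^ a * (m ^ 2 + 1) ^ b) :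
    1 ≤ ((q : ℝ) / (A : ℝ)) ^ a * ((m : ℝ) + 1 / (m : ℝ)) ^ b := by
  have h' : (A : ℝ) ^ a * (m : ℝ) ^ b ≤ (q : ℝ) ^ a * ((m : ℝ) ^ 2 + 1) ^ b := by
    exact_mod_cast h
  have hm' : (0 : ℝ) < (m : ℝ) := by exact_mod_cast hm
  have hA' : (0 : ℝ) < (A : ℝ) := by exact_mod_cast hA
  have e : (m : ℝ) + 1 / m = ((m : ℝ) ^ 2 + 1) / m := by field_simp
  rw [e, div_pow, div_pow, div_mul_div_comm]
  exact (one_le_div (by positivity)).2 h'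

lemma L_num : ∀ k < 45, (Lq.getD k 0) ^ 50 * ((k + 1) ^ 2 + 1) ^ 91 ≤
    1000000 ^ 50 * (k + 1) ^ 91 := by
  decide +kernel

lemma U_num : ∀ k < 19, 1000000 ^ 100 * (k + 1) ^ 183 ≤
    (Uq.getD k 0) ^ 100 * ((k + 1) ^ 2 + 1) ^ 183 := by
  decide +kernel

lemma L_ok (k : ℕ) (hk : k < 45) :
    ((Lq.getD k 0 : ℕ) : ℝ) / ((1000000 : ℕ) : ℝ) ≤ ff (-1.82) k :=
  lo_aux _ _ _ (by linarith [base_ge k]) 50 91 (by norm_num) (by norm_num)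
    (cast_lo _ _ _ 50 91 (Nat.succ_pos k) (by norm_num) (L_num k hk))

lemma U_ok (k : ℕ) (hk : k < 19) :
    ff (-1.83) k ≤ ((Uq.getD k 0 : ℕ) : ℝ) / ((1000000 : ℕ) : ℝ) :=
  hi_aux _ _ _ (by linarith [base_ge k]) (by positivity) 100 183 (by norm_num) (by norm_num)
    (cast_hi _ _ _ 100 183 (Nat.succ_pos k) (by norm_num) (U_num k hk))

lemma ff_summable (t : ℝ) (ht : t < -1) : Summable (ff t) := by
  have h : Summable (fun n : ℕ => ((n + 1 : ℕ) : ℝ) ^ t) :=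
    (summable_nat_add_iff 1).2 (Real.summable_nat_rpow.2 ht)
  refine Summable.of_nonneg_of_le (fun n => (ff_pos t n).le) (fun n => ?_) h
  have : 0 < 1 / ((n + 1 : ℕ) : ℝ) := by positivity
  exact Real.rpow_le_rpow_of_nonpos (by positivity) (by linarith) (by linarith)

lemma lower : 1 < ∑' n, ff (-1.82) n := by
  have key : ∀ k : ℕ, 45 ≤ k → (1.0001 : ℝ) ≤ ∑ n ∈ Finset.range k, ff (-1.82) n
      + ((k : ℝ) + (1 + 1 / 46)) ^ (-0.82 : ℝ) / 0.82 := by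
    intro k hk
    induction k, hk using Nat.le_induction with
    | base =>
      have h1 : ∑ n ∈ Finset.range 45, ((Lq.getD n 0 : ℕ) : ℝ) / ((1000000 : ℕ) : ℝ)
          ≤ ∑ n ∈ Finset.range 45, ff (-1.82) n :=
        Finset.sum_le_sum fun n hn => L_ok n (Finset.mem_range.1 hn)
      have h2 : (43288 / 10 ^ 6 : ℝ) ≤ (((45 : ℕ) : ℝ) + (1 + 1 / 46)) ^ (-0.82 : ℝ) := by
        apply lo_aux _ _ _ (by norm_num) 50 41 (by norm_num) (by norm_num)
        norm_num
      rw [← Finset.sum_div, ← Nat.cast_sum] at h1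
      have h3 : ∑ n ∈ Finset.range 45, Lq.getD n 0 = 947679 := by decide +kernel
      rw [h3] at h1
      have h4 := div_le_div_of_nonneg_right h2 (by norm_num : (0 : ℝ) ≤ 0.82)
      refine le_trans ?_ (add_le_add h1 h4)
      norm_num
    | succ k hk ih =>
      rw [Finset.sum_range_succ]
      have h := mvt_lo 0.82 (by norm_num) ((k : ℝ) + (1 + 1 / 46)) (by positivity)
      have h2 : ((k : ℝ) + (1 + 1 / 46)) ^ (-(0.82 + 1) : ℝ) ≤ ff (-1.82) k := by
        have e : (-(0.82 + 1) : ℝ) = -1.82 := by norm_num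
        rw [e]
        apply Real.rpow_le_rpow_of_nonpos (by linarith [base_ge k]) _ (by norm_num)
        have : (1 : ℝ) / ((k + 1 : ℕ) : ℝ) ≤ 1 / 46 := by
          apply one_div_le_one_div_of_le (by norm_num)
          exact_mod_cast Nat.succ_le_succ hk
        push_cast at this ⊢
        linarith
      have e : (((k + 1 : ℕ) : ℝ) + (1 + 1 / 46)) = (k : ℝ) + (1 + 1 / 46) + 1 := by
        push_cast; ring
      rw [e]
      linarith
  have lim : Filter.Tendsto (fun k : ℕ => ∑ n ∈ Finset.range k, ff (-1.82) n
      + ((k : ℝ) + (1 + 1 / 46)) ^ (-0.82 : ℝ) / 0.82) Filter.atTop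
      (nhds (∑' n, ff (-1.82) n + 0 / 0.82)) := by
    apply Filter.Tendsto.add (ff_summable _ (by norm_num)).hasSum.tendsto_sum_nat
    apply Filter.Tendsto.div_const
    exact (tendsto_rpow_neg_atTop (by norm_num : (0 : ℝ) < 0.82)).comp
      (Filter.tendsto_atTop_add_const_right _ _ tendsto_natCast_atTop_atTop)
  have := ge_of_tendsto lim (Filter.eventually_atTop.2 ⟨45, key⟩)
  norm_num at this ⊢
  linarith

lemma upper : ∑' n, ff (-1.83) n < 1 := by
  have key : ∀ k : ℕ, 19 ≤ k → ∑ n ∈ Finset.range k, ff (-1.83) n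
      + (k : ℝ) ^ (-0.83 : ℝ) / 0.83 ≤ (0.999 : ℝ) := by
    intro k hk
    induction k, hk using Nat.le_induction with
    | base =>
      have h1 : ∑ n ∈ Finset.range 19, ff (-1.83) n
          ≤ ∑ n ∈ Finset.range 19, ((Uq.getD n 0 : ℕ) : ℝ) / ((1000000 : ℕ) : ℝ) :=
        Finset.sum_le_sum fun n hn => U_ok n (Finset.mem_range.1 hn)
      have h2 : ((19 : ℕ) : ℝ) ^ (-0.83 : ℝ) ≤ (86823 / 10 ^ 6 : ℝ) := by
        apply hi_aux _ _ _ (by norm_num) (by norm_num) 100 83 (by norm_num) (by norm_num)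
        norm_num
      rw [← Finset.sum_div, ← Nat.cast_sum] at h1
      have h3 : ∑ n ∈ Finset.range 19, Uq.getD n 0 = 883326 := by decide +kernel
      rw [h3] at h1
      have h4 := div_le_div_of_nonneg_right h2 (by norm_num : (0 : ℝ) ≤ 0.83)
      refine le_trans (add_le_add h1 h4) ?_
      norm_num
    | succ k hk ih =>
      rw [Finset.sum_range_succ]
      have hk0 : (0 : ℝ) < k := by exact_mod_cast (by omega : 0 < k)
      have h := mvt_hi 0.83 (by norm_num) (k : ℝ) hk0
      have h2 : ff (-1.83) k ≤ ((k : ℝ) + 1) ^ (-(0.83 + 1) : ℝ) := by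
        have e : (-(0.83 + 1) : ℝ) = -1.83 := by norm_num
        rw [e]
        apply Real.rpow_le_rpow_of_nonpos (by positivity) _ (by norm_num)
        have : 0 < 1 / ((k + 1 : ℕ) : ℝ) := by positivity
        push_cast at this ⊢
        linarith
      push_cast
      linarith
  have lim := (ff_summable (-1.83) (by norm_num)).hasSum.tendsto_sum_nat
  have h : ∑' n, ff (-1.83) n ≤ (0.999 : ℝ) := by
    refine le_of_tendsto lim (Filter.eventually_atTop.2 ⟨19, fun k hk => ?_⟩)
    have h1 := key k hk
    have h2 : 0 ≤ (k : ℝ) ^ (-0.83 : ℝ) / 0.83 := by positivity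
    linarith
  exact lt_of_le_of_lt h (by norm_num)

lemma cont : ContinuousOn (fun t => ∑' n, ff t n) (Set.Icc (-1.83) (-1.82)) := by
  apply continuousOn_tsum (u := ff (-1.82)) _ (ff_summable _ (by norm_num))
  · intro n t ht
    rw [Real.norm_of_nonneg (ff_pos t n).le]
    exact Real.rpow_le_rpow_of_exponent_le (base_ge n).le ht.2
  · intro n
    apply Continuous.continuousOn
    exact Real.continuous_const_rpow (by linarith [base_ge n])

lemma ff_strict {s t : ℝ} (h : s < t) (hs : Summable (ff s)) (ht : Summable (ff t)) :
    ∑' n, ff s n < ∑' n, ff t n :=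
  Summable.tsum_lt_tsum (i := 0)
    (fun n => Real.rpow_le_rpow_of_exponent_le (base_ge n).le h.le)
    (Real.rpow_lt_rpow_of_exponent_lt (base_ge 0) h) hs ht

lemma trans_iff (t : ℝ) : (Summable (fun n : ℕ+ => ((n : ℝ) + 1 / (n : ℝ)) ^ t) ∧
        ∑' n : ℕ+, ((n : ℝ) + 1 / (n : ℝ)) ^ t = 1) ↔ (Summable (ff t) ∧ ∑' n, ff t n = 1) := by
  have h1 := summable_pnat_iff_summable_succ (f := fun n : ℕ => ((n : ℝ) + 1 / (n : ℝ)) ^ t)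
  have h2 := tsum_pnat_eq_tsum_succ (f := fun n : ℕ => ((n : ℝ) + 1 / (n : ℝ)) ^ t)
  exact and_congr h1 (by rw [h2]; rfl)


/-- There is a unique real `t'` such that the family
`((n + 1/n) ^ t')_{n ≥ 1}` is summable with sum `1`; moreover `-1.83 < t' < -1.82`. -/
theorem stmt12 :
    ∃ t' : ℝ,
      (-1.83 < t' ∧ t' < -1.82) ∧
      (Summable (fun n : ℕ+ => ((n : ℝ) + 1 / (n : ℝ)) ^ t') ∧
        ∑' n : ℕ+, ((n : ℝ) + 1 / (n : ℝ)) ^ t' = 1) ∧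
      ∀ t : ℝ,
        (Summable (fun n : ℕ+ => ((n : ℝ) + 1 / (n : ℝ)) ^ t) ∧
          ∑' n : ℕ+, ((n : ℝ) + 1 / (n : ℝ)) ^ t = 1) → t = t' := by
  obtain ⟨t', ht, h1⟩ := intermediate_value_Ioo (by norm_num) cont ⟨upper, lower⟩
  have hs : Summable (ff t') := ff_summable _ (by
    have := ht.2
    norm_num at this ⊢
    linarith)
  refine ⟨t', ht, (trans_iff t').2 ⟨hs, h1⟩, fun t h => ?_⟩
  obtain ⟨h2, h3⟩ := (trans_iff t).1 h
  simp only at h1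
  rcases lt_trichotomy t t' with h4 | h4 | h4
  · linarith [ff_strict h4 h2 hs]
  · exact h4
  · linarith [ff_strict h4 hs h2]
end

section
/- There exists a real number t_c with −2.18 < t_c < −1.82 such that P(t) = 0 for every t ≤ t_c and P(t) > 0 for every t > t_c, where P(t) := lim_{n→∞} (1/n) log ∑_{I ∈ {1,2}^n} ‖A_{i_{n−1}} ⋯ A_{i_0}‖^t. -/
open Filter

/-- For a word `I = (i₀, …, i_{n-1}) ∈ {1,2}ⁿ` (symbol `1` encoded as `0 : Fin 2`,
symbol `2` as `1 : Fin 2`), the matrix `𝒜_I = A_{i_{n-1}} ⋯ A_{i₁} A_{i₀}`. -/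
def wordProd (n : ℕ) (I : Fin n → Fin 2) : Matrix (Fin 2) (Fin 2) ℝ :=
  ((List.ofFn fun l : Fin n => if I l = 0 then A1 else A2).reverse).prod

/-- `s_n(t) = ∑_{I ∈ {1,2}ⁿ} ‖𝒜_I‖^t`. -/
noncomputable def sFun (n : ℕ) (t : ℝ) : ℝ :=
  ∑ I : Fin n → Fin 2, opNorm (wordProd n I) ^ t


def GG (φ : ℝ → ℝ → ℝ) : ℕ → ℝ → ℝ → ℝ
  | 0 => φ
  | n + 1 => fun p q => GG φ n p (p + q) + GG φ n (p + q) q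

lemma wordProd_cons (n : ℕ) (i : Fin 2) (J : Fin n → Fin 2) :
    wordProd (n + 1) (Fin.cons i J) = wordProd n J * (if i = 0 then A1 else A2) := by
  simp [wordProd, List.ofFn_succ]

lemma sum_words (n : ℕ) (f : (Fin (n + 1) → Fin 2) → ℝ) :
    ∑ I, f I = ∑ J : Fin n → Fin 2, f (Fin.cons 0 J) + ∑ J : Fin n → Fin 2, f (Fin.cons 1 J) := by
  rw [← (Fin.consEquiv (fun _ => Fin 2)).sum_comp, Fintype.sum_prod_type]
  simp [Fin.consEquiv]

/-- matrix applied to a column vector, as two coordinates -/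
lemma GG_eq (φ : ℝ → ℝ → ℝ) (n : ℕ) (p q : ℝ) :
    GG φ n p q = ∑ I : Fin n → Fin 2,
      φ (wordProd n I 0 0 * p + wordProd n I 0 1 * q) (wordProd n I 1 0 * p + wordProd n I 1 1 * q) := by
  induction n generalizing p q with
  | zero => simp [GG, wordProd]
  | succ n ih =>
    rw [sum_words]
    simp only [GG, ih, wordProd_cons]
    congr 1 <;>
    · refine Finset.sum_congr rfl fun J _ => ?_
      congr 1 <;> simp [Matrix.mul_apply, Fin.sum_univ_two, A1, A2] <;> ring

lemma word_ind (Q : Matrix (Fin 2) (Fin 2) ℝ → Prop) (h1 : Q 1)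
    (hs : ∀ M, Q M → Q (M * A1) ∧ Q (M * A2)) (n : ℕ) (I : Fin n → Fin 2) : Q (wordProd n I) := by
  induction n with
  | zero => simpa [wordProd] using h1
  | succ n ih =>
    rw [← Fin.cons_self_tail I, wordProd_cons]
    have := hs _ (ih (Fin.tail I))
    split_ifs
    · exact this.1
    · exact this.2

lemma word_nonneg (n : ℕ) (I : Fin n → Fin 2) : ∀ i j, 0 ≤ wordProd n I i j := by
  refine word_ind (fun M => ∀ i j, 0 ≤ M i j) ?_ ?_ n I
  · intro i j; fin_cases i <;> fin_cases j <;> simp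
  · intro M h
    have a := h 0 0
    have b := h 0 1
    have c := h 1 0
    have d := h 1 1
    constructor <;> intro i j <;> fin_cases i <;> fin_cases j <;>
      simp [Matrix.mul_apply, Fin.sum_univ_two, A1, A2] <;> linarith

lemma word_pos (n : ℕ) (I : Fin n → Fin 2) :
    1 ≤ wordProd n I 0 0 + wordProd n I 0 1 ∧ 1 ≤ wordProd n I 1 0 + wordProd n I 1 1 := by
  have := word_ind (fun M => (∀ i j, 0 ≤ M i j) ∧ 1 ≤ M 0 0 + M 0 1 ∧ 1 ≤ M 1 0 + M 1 1) ?_ ?_ n I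
  · exact this.2
  · refine ⟨?_, by simp⟩
    intro i j; fin_cases i <;> fin_cases j <;> simp
  · rintro M ⟨h, h1, h2⟩
    have a := h 0 0
    have b := h 0 1
    have c := h 1 0
    have d := h 1 1
    refine ⟨⟨?_, ?_, ?_⟩, ⟨?_, ?_, ?_⟩⟩ <;>
     (try (intro i j; fin_cases i <;> fin_cases j)) <;>
      simp [Matrix.mul_apply, Fin.sum_univ_two, A1, A2] <;> linarith

lemma opNorm_le (M : Matrix (Fin 2) (Fin 2) ℝ) (h : ∀ i j, 0 ≤ M i j) :
    opNorm M ≤ (M 0 0 + M 0 1) + (M 1 0 + M 1 1) := by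
  have a := h 0 0
  have b := h 0 1
  have c := h 1 0
  have d := h 1 1
  refine ContinuousLinearMap.opNorm_le_bound _ (by positivity) fun x => ?_
  refine abs_le_of_sq_le_sq' ?_ (by positivity) |>.2
  rw [mul_pow, EuclideanSpace.norm_sq_eq, EuclideanSpace.norm_sq_eq]
  simp only [Fin.sum_univ_two, Real.norm_eq_abs, sq_abs, Matrix.ofLp_toEuclideanCLM, Matrix.mulVec,
    dotProduct]
  have e : (M 0 0 * x 0 + M 0 1 * x 1)^2 + (M 1 0 * x 0 + M 1 1 * x 1)^2 ≤
      (M 0 0^2 + M 0 1^2 + M 1 0^2 + M 1 1^2) * (x 0^2 + x 1^2) := by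
    nlinarith [sq_nonneg (M 0 0 * x 1 - M 0 1 * x 0), sq_nonneg (M 1 0 * x 1 - M 1 1 * x 0)]
  refine e.trans (mul_le_mul_of_nonneg_right ?_ (by positivity))
  nlinarith [mul_nonneg a b, mul_nonneg a c, mul_nonneg a d, mul_nonneg b c, mul_nonneg b d,
    mul_nonneg c d]

lemma opNorm_ge (M : Matrix (Fin 2) (Fin 2) ℝ) :
    (M 0 0 + M 0 1) * (M 1 0 + M 1 1) ≤ opNorm M ^ 2 := by
  have h := (Matrix.toEuclideanCLM (𝕜 := ℝ) M).le_opNorm (WithLp.toLp 2 ![1, 1])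
  have h2 := pow_le_pow_left₀ (norm_nonneg _) h 2
  rw [mul_pow, EuclideanSpace.norm_sq_eq, EuclideanSpace.norm_sq_eq] at h2
  simp [Matrix.mulVec, dotProduct, Fin.sum_univ_two] at h2
  unfold opNorm
  nlinarith [sq_nonneg ((M 0 0 + M 0 1) - (M 1 0 + M 1 1))]

lemma one_le_opNorm (n : ℕ) (I : Fin n → Fin 2) : 1 ≤ opNorm (wordProd n I) := by
  have h := opNorm_ge (wordProd n I)
  obtain ⟨a, b⟩ := word_pos n I
  have h0 : 0 ≤ opNorm (wordProd n I) := norm_nonneg _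
  nlinarith

lemma opNorm_le_pow (n : ℕ) (I : Fin n → Fin 2) : opNorm (wordProd n I) ≤ 3 ^ n := by
  induction n with
  | zero => simp [wordProd, opNorm]
  | succ n ih =>
    rw [← Fin.cons_self_tail I, wordProd_cons, pow_succ]
    have h1 : opNorm A1 ≤ 3 := by
      refine (opNorm_le _ ?_).trans ?_
      · intro i j; fin_cases i <;> fin_cases j <;> simp [A1]
      · norm_num [A1]
    have h2 : opNorm A2 ≤ 3 := by
      refine (opNorm_le _ ?_).trans ?_
      · intro i j; fin_cases i <;> fin_cases j <;> simp [A2]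
      · norm_num [A2]
    have hm : ∀ M N, opNorm (M * N) ≤ opNorm M * opNorm N := by
      intro M N
      unfold opNorm
      rw [map_mul]
      exact norm_mul_le _ _
    refine (hm _ _).trans (mul_le_mul (ih _) ?_ (norm_nonneg _) (by positivity))
    split_ifs
    · exact h1
    · exact h2

lemma sFun_pos (n : ℕ) (t : ℝ) : 0 < sFun n t :=
  Finset.sum_pos (fun I _ => Real.rpow_pos_of_pos (by linarith [one_le_opNorm n I]) _)
    Finset.univ_nonempty

lemma sFun_mono (n : ℕ) {s t : ℝ} (h : s ≤ t) : sFun n s ≤ sFun n t :=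
  Finset.sum_le_sum fun I _ => Real.rpow_le_rpow_of_exponent_le (one_le_opNorm n I) h

lemma sFun_lip (n : ℕ) {s t : ℝ} (h : s ≤ t) : sFun n t ≤ (3 ^ n : ℝ) ^ (t - s) * sFun n s := by
  unfold sFun
  rw [Finset.mul_sum]
  refine Finset.sum_le_sum fun I _ => ?_
  have h1 := one_le_opNorm n I
  have : t = (t - s) + s := by ring
  conv_lhs => rw [this]
  rw [Real.rpow_add (by linarith)]
  gcongr
  exact opNorm_le_pow n I

lemma sFun_neg_two (n : ℕ) : sFun n (-2) ≤ 1 := by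
  have hG : ∀ n : ℕ, ∀ p q : ℝ, 0 < p → 0 < q → GG (fun x y => 1 / (x * y)) n p q = 1 / (p * q) := by
    intro n
    induction n with
    | zero => intro p q _ _; rfl
    | succ n ih =>
      intro p q hp hq
      simp only [GG]
      rw [ih _ _ hp (by positivity), ih _ _ (by positivity) hq]
      field_simp
      ring
  have h := hG n 1 1 one_pos one_pos
  rw [GG_eq] at h
  norm_num at h
  rw [← h]
  refine Finset.sum_le_sum fun I _ => ?_
  obtain ⟨a, b⟩ := word_pos n I
  have h1 := one_le_opNorm n I
  rw [Real.rpow_neg (by linarith)]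
  have := opNorm_ge (wordProd n I)
  rw [← mul_inv_rev]
  refine inv_anti₀ (mul_pos (by linarith) (by linarith)) ?_
  exact_mod_cast this

lemma sFun_lower (n : ℕ) {t : ℝ} (ht : t ≤ 0) : ((n : ℝ) + 2) ^ t ≤ sFun n t := by
  have hw : ∀ n : ℕ, wordProd n (fun _ => 0) = !![1, 0; (n : ℝ), 1] := by
    intro n
    induction n with
    | zero => simp [wordProd, Matrix.one_fin_two]
    | succ n ih =>
      have : (fun _ : Fin (n + 1) => (0 : Fin 2)) = Fin.cons 0 (fun _ : Fin n => (0 : Fin 2)) := by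
        funext i
        refine Fin.cases ?_ (fun j => ?_) i <;> simp
      rw [this, wordProd_cons, ih]
      simp [A1]
  have h1 := opNorm_le _ (word_nonneg n (fun _ => 0))
  have h0 := one_le_opNorm n (fun _ => 0)
  have h2 : opNorm (wordProd n (fun _ => 0)) ≤ n + 2 := by
    refine h1.trans ?_
    rw [hw]
    simp
    linarith
  refine (Real.rpow_le_rpow_of_nonpos (by linarith) h2 ht).trans ?_
  unfold sFun
  exact Finset.single_le_sum (f := fun I => opNorm (wordProd n I) ^ t)
    (fun I _ => Real.rpow_nonneg (by linarith [one_le_opNorm n I]) _) (Finset.mem_univ (fun _ => 0))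

/-- the test function -/
noncomputable def psi (p q : ℝ) : ℝ := ((p + q) / 2) ^ (-(11 / 6) : ℝ)

lemma mid_rpow {x y : ℝ} (hx : 0 < x) (hy : 0 < y) :
    2 * ((x + y) / 2) ^ (-(11 / 6) : ℝ) ≤ x ^ (-(11 / 6) : ℝ) + y ^ (-(11 / 6) : ℝ) := by
  have h1 : √x * √y ≤ (x + y) / 2 := by
    nlinarith [sq_nonneg (√x - √y), Real.sq_sqrt hx.le, Real.sq_sqrt hy.le]
  have hx' := Real.sqrt_pos.2 hx
  have hy' := Real.sqrt_pos.2 hy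
  have h2 := Real.rpow_le_rpow_of_nonpos (mul_pos hx' hy') h1 (show (-(11 / 6) : ℝ) ≤ 0 by norm_num)
  rw [Real.mul_rpow hx'.le hy'.le] at h2
  have e : ∀ z : ℝ, 0 < z → z ^ (-(11 / 6) : ℝ) = (√z ^ (-(11 / 6) : ℝ)) ^ 2 := by
    intro z hz
    have := Real.sqrt_pos.2 hz
    conv_lhs => rw [← Real.sq_sqrt hz.le]
    rw [sq, sq, Real.mul_rpow this.le this.le]
  rw [e x hx, e y hy]
  nlinarith [sq_nonneg (√x ^ (-(11 / 6) : ℝ) - √y ^ (-(11 / 6) : ℝ))]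

lemma GG_conv (n : ℕ) : ∀ p q p' q' : ℝ, 0 < p → 0 < q → 0 < p' → 0 < q' →
    2 * GG psi n ((p + p') / 2) ((q + q') / 2) ≤ GG psi n p q + GG psi n p' q' := by
  induction n with
  | zero =>
    intro p q p' q' h1 h2 h3 h4
    have := mid_rpow (show 0 < (p + q) / 2 by positivity) (show 0 < (p' + q') / 2 by positivity)
    simp only [GG, psi]
    convert this using 3
    ring
  | succ n ih =>
    intro p q p' q' h1 h2 h3 h4
    have a := ih p (p + q) p' (p' + q') h1 (by positivity) h3 (by positivity)
    have b := ih (p + q) q (p' + q') q' (by positivity) h2 (by positivity) h4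
    simp only [GG]
    have e : (p + p') / 2 + (q + q') / 2 = ((p + q) + (p' + q')) / 2 := by ring
    rw [e]
    linarith

lemma GG_symm (n : ℕ) : ∀ p q : ℝ, GG psi n p q = GG psi n q p := by
  induction n with
  | zero => intro p q; simp [GG, psi, add_comm]
  | succ n ih =>
    intro p q
    simp only [GG]
    rw [ih p (p + q), ih (p + q) q, add_comm q p, add_comm]

lemma GG_homog (n : ℕ) : ∀ p q c : ℝ, 0 < p → 0 < q → 0 < c →
    GG psi n (c * p) (c * q) = c ^ (-(11 / 6) : ℝ) * GG psi n p q := by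
  induction n with
  | zero =>
    intro p q c hp hq hc
    simp only [GG, psi]
    rw [← Real.mul_rpow hc.le (by positivity)]
    congr 1
    ring
  | succ n ih =>
    intro p q c hp hq hc
    simp only [GG]
    rw [← mul_add, ih _ _ _ hp (by positivity) hc, ih _ _ _ (by positivity) hq hc]
    ring

lemma GG_lower (n : ℕ) (p q : ℝ) (hp : 0 < p) (hq : 0 < q) :
    GG psi n 1 1 * psi p q ≤ GG psi n p q := by
  have h := GG_conv n p q q p hp hq hq hp
  rw [GG_symm n q p] at h
  have := GG_homog n 1 1 ((p + q) / 2) one_pos one_pos (by positivity)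
  rw [mul_one] at this
  rw [add_comm q p, this] at h
  have e : psi p q = ((p + q) / 2) ^ (-(11 / 6) : ℝ) := rfl
  rw [e]
  linarith

lemma GG_iter (m : ℕ) (ρ : ℝ) (φ χ : ℝ → ℝ → ℝ)
    (h : ∀ p q : ℝ, 0 < p → 0 < q → ρ * φ p q ≤ χ p q) :
    ∀ p q : ℝ, 0 < p → 0 < q → ρ * GG φ m p q ≤ GG χ m p q := by
  induction m with
  | zero => exact h
  | succ m ih =>
    intro p q hp hq
    simp only [GG]
    have a := ih p (p + q) hp (by positivity)
    have b := ih (p + q) q (by positivity) hq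
    linarith

lemma GG_add (φ : ℝ → ℝ → ℝ) (n m : ℕ) : GG φ (n + m) = GG (GG φ n) m := by
  induction m with
  | zero => rfl
  | succ m ih => rw [← add_assoc]; funext p q; simp only [GG, ih]

/-- numerics -/
def KK (s : ℕ) : ℕ := Nat.findGreatest (fun k => k ^ 6 * 2 ≤ s * 128 ^ 6) 300

def hh (s : ℕ) : ℕ := 1000000 * 4 * KK s / (128 * s ^ 2)

def NG : ℕ → ℕ → ℕ → ℕ
  | 0 => fun p q => hh (p + q)
  | n + 1 => fun p q => NG n p (p + q) + NG n (p + q) q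

lemma hh_le (s : ℕ) (hs : 0 < s) :
    (hh s : ℝ) / 1000000 ≤ ((s : ℝ) / 2) ^ (-(11 / 6) : ℝ) := by
  have hK : (KK s) ^ 6 * 2 ≤ s * 128 ^ 6 :=
    Nat.findGreatest_spec (P := fun k => k ^ 6 * 2 ≤ s * 128 ^ 6) (m := 0) (by norm_num) (by simp)
  have hK' : ((KK s : ℝ)) ^ 6 * 2 ≤ s * 128 ^ 6 := by exact_mod_cast hK
  have hs' : (0 : ℝ) < s := by exact_mod_cast hs
  have h1 : (hh s : ℝ) ≤ 1000000 * 4 * KK s / (128 * s ^ 2) := by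
    have := @Nat.cast_div_le ℝ _ _ _ (1000000 * 4 * KK s) (128 * s ^ 2)
    simpa only [hh, Nat.cast_mul, Nat.cast_pow, Nat.cast_ofNat] using this
  have h2 : (KK s : ℝ) / 128 ≤ ((s : ℝ) / 2) ^ (1 / 6 : ℝ) := by
    have h3 : ((KK s : ℝ) / 128) ^ 6 ≤ (s : ℝ) / 2 := by
      rw [div_pow, div_le_div_iff₀ (by positivity) (by norm_num)]
      exact hK'
    calc (KK s : ℝ) / 128 = (((KK s : ℝ) / 128) ^ 6) ^ (1 / 6 : ℝ) := by
          rw [← Real.rpow_natCast, ← Real.rpow_mul (by positivity)]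
          norm_num
      _ ≤ _ := Real.rpow_le_rpow (by positivity) h3 (by norm_num)
  have h4 : ((s : ℝ) / 2) ^ (-(11 / 6) : ℝ) = ((s : ℝ) / 2) ^ (1 / 6 : ℝ) / ((s : ℝ) / 2) ^ 2 := by
    rw [← Real.rpow_natCast, ← Real.rpow_sub (by positivity)]
    norm_num
  rw [h4]
  calc (hh s : ℝ) / 1000000 ≤ (1000000 * 4 * KK s / (128 * s ^ 2)) / 1000000 := by gcongr
    _ = (KK s : ℝ) / 128 / ((s : ℝ) / 2) ^ 2 := by field_simp; ring
    _ ≤ _ := by gcongr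

lemma NG_le (n : ℕ) : ∀ p q : ℕ, 0 < p → 0 < q → (NG n p q : ℝ) / 1000000 ≤ GG psi n p q := by
  induction n with
  | zero =>
    intro p q hp hq
    have := hh_le (p + q) (by omega)
    simpa [NG, GG, psi] using this
  | succ n ih =>
    intro p q hp hq
    have a := ih p (p + q) hp (by omega)
    have b := ih (p + q) q (by omega) hq
    simp only [NG, GG]
    push_cast at a b ⊢
    linarith

lemma GG8 : 1.01 ≤ GG psi 8 1 1 := by
  have h := NG_le 8 1 1 one_pos one_pos
  have h2 : 1010000 ≤ NG 8 1 1 := by decide +kernel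
  have h3 : (1010000 : ℝ) ≤ NG 8 1 1 := by exact_mod_cast h2
  push_cast at h
  refine le_trans ?_ h
  rw [le_div_iff₀ (by norm_num)]
  linarith

lemma GG_grow (k : ℕ) : (1.01 : ℝ) ^ k ≤ GG psi (8 * k) 1 1 := by
  have : ∀ p q : ℝ, 0 < p → 0 < q → (1.01 : ℝ) ^ k * psi p q ≤ GG psi (8 * k) p q := by
    induction k with
    | zero => intro p q _ _; simp [GG]
    | succ k ih =>
      intro p q hp hq
      have h8 : ∀ p q : ℝ, 0 < p → 0 < q → 1.01 * psi p q ≤ GG psi 8 p q := by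
        intro p q hp hq
        refine le_trans ?_ (GG_lower 8 p q hp hq)
        refine mul_le_mul_of_nonneg_right GG8 ?_
        unfold psi
        positivity
      have := GG_iter (8 * k) 1.01 psi (GG psi 8) h8 p q hp hq
      rw [← GG_add] at this
      rw [mul_add, mul_one, add_comm (8 * k) 8]
      have := ih p q hp hq
      rw [pow_succ]
      linarith
  have h := this 1 1 one_pos one_pos
  simpa [psi] using h

lemma sFun_grow (k : ℕ) :
    (2 : ℝ) ^ (-(11 / 6) : ℝ) * (1.01 : ℝ) ^ k ≤ sFun (8 * k) (-(11 / 6)) := by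
  refine (mul_le_mul_of_nonneg_left (GG_grow k) (by positivity)).trans ?_
  rw [GG_eq, Finset.mul_sum]
  refine Finset.sum_le_sum fun I _ => ?_
  have h1 := one_le_opNorm _ I
  have h2 := opNorm_le _ (word_nonneg _ I)
  unfold psi
  rw [← Real.mul_rpow (by norm_num) (by linarith)]
  refine Real.rpow_le_rpow_of_nonpos (by linarith) ?_ (by norm_num)
  linarith

theorem stmt17 (P : ℝ → ℝ)
    (hP : ∀ t : ℝ, Tendsto (fun n : ℕ => Real.log (sFun n t) / n) atTop (nhds (P t))) :
    ∃ tc : ℝ, -2.18 < tc ∧ tc < -1.82 ∧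
      (∀ t : ℝ, t ≤ tc → P t = 0) ∧ (∀ t : ℝ, tc < t → 0 < P t) := by
  have hmono : ∀ s t, s ≤ t → P s ≤ P t := by
    intro s t h
    refine le_of_tendsto_of_tendsto' (hP s) (hP t) fun n => ?_
    have := Real.log_le_log (sFun_pos n s) (sFun_mono n h)
    gcongr
  have hlip : ∀ s t, s ≤ t → P t ≤ P s + (t - s) * Real.log 3 := by
    intro s t h
    refine le_of_tendsto_of_tendsto (hP t) ((hP s).add_const _) ?_
    filter_upwards [eventually_gt_atTop 0] with n hn
    have h0 := sFun_pos n s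
    have := Real.log_le_log (sFun_pos n t) (sFun_lip n h)
    rw [Real.log_mul (by positivity) h0.ne', Real.log_rpow (by positivity), Real.log_pow] at this
    have hn' : (0 : ℝ) < n := by exact_mod_cast hn
    rw [div_add' _ _ _ hn'.ne']
    gcongr
    linarith
  have hm2 : P (-2) ≤ 0 := by
    refine le_of_tendsto' (hP (-2)) fun n => ?_
    exact div_nonpos_of_nonpos_of_nonneg (Real.log_nonpos (sFun_pos _ _).le (sFun_neg_two n))
      (Nat.cast_nonneg _)
  have hnn : ∀ t, t ≤ 0 → 0 ≤ P t := by
    intro t ht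
    have hl : Tendsto (fun n : ℕ => t * (Real.log ((n : ℝ) + 2) / n)) atTop (nhds 0) := by
      have h1 : Tendsto (fun x : ℝ => Real.log (x + 2) / x) atTop (nhds 0) := by
        have h2 : Tendsto (fun x : ℝ => Real.log x / x) atTop (nhds 0) := by
          have := Real.isLittleO_log_id_atTop.tendsto_div_nhds_zero
          simpa using this
        have h3 : Tendsto (fun x : ℝ => 2 * (Real.log x / x)) atTop (nhds 0) := by
          simpa using h2.const_mul 2
        refine squeeze_zero' ?_ ?_ h3
        · filter_upwards [eventually_ge_atTop 2] with x hx
          exact div_nonneg (Real.log_nonneg (by linarith)) (by linarith)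
        · filter_upwards [eventually_ge_atTop 2] with x hx
          have : Real.log (x + 2) ≤ 2 * Real.log x := by
            rw [show 2 * Real.log x = Real.log (x ^ 2) by rw [Real.log_pow]; norm_num]
            exact Real.log_le_log (by linarith) (by nlinarith)
          rw [← mul_div_assoc]
          gcongr
      simpa using (h1.comp tendsto_natCast_atTop_atTop).const_mul t
    refine le_of_tendsto_of_tendsto' hl (hP t) fun n => ?_
    have := Real.log_le_log (by positivity) (sFun_lower n ht)
    rw [Real.log_rpow (by positivity)] at this
    rw [← mul_div_assoc]
    gcongr
  have hpos : 0 < P (-(11 / 6)) := by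
    have hsub : Tendsto (fun k : ℕ => 8 * (k + 1)) atTop atTop :=
      tendsto_atTop_mono (fun k => by show k ≤ 8 * (k + 1); omega) tendsto_id
    have h1 := (hP (-(11 / 6))).comp hsub
    have hl : Tendsto (fun k : ℕ => (-(11 / 6) * Real.log 2 / 8) * (1 / ((k : ℝ) + 1)) +
        Real.log 1.01 / 8) atTop (nhds ((-(11 / 6) * Real.log 2 / 8) * 0 + Real.log 1.01 / 8)) :=
      (tendsto_one_div_add_atTop_nhds_zero_nat.const_mul _).add_const _
    have h2 := le_of_tendsto_of_tendsto' hl h1 fun k => ?_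
    · have : 0 < Real.log 1.01 := Real.log_pos (by norm_num)
      linarith
    · have := Real.log_le_log (by positivity) (sFun_grow (k + 1))
      rw [Real.log_mul (by positivity) (by positivity), Real.log_rpow (by positivity),
        Real.log_pow] at this
      simp only [Function.comp]
      rw [le_div_iff₀ (by positivity)]
      refine le_trans (le_of_eq ?_) this
      push_cast
      field_simp
  have hbdd : ∀ t ∈ {t | P t ≤ 0}, t ≤ -(11 / 6) := by
    intro t ht
    by_contra! hc
    have := hmono _ _ hc.le
    have ht' : P t ≤ 0 := ht
    linarith
  have hB : BddAbove {t | P t ≤ 0} := ⟨_, hbdd⟩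
  have hne : ({t | P t ≤ 0} : Set ℝ).Nonempty := ⟨-2, hm2⟩
  have hge : -2 ≤ sSup {t | P t ≤ 0} := le_csSup hB hm2
  have hle : sSup {t | P t ≤ 0} ≤ -(11 / 6) := csSup_le hne hbdd
  refine ⟨sSup {t | P t ≤ 0}, by linarith, by linarith, ?_, ?_⟩
  · intro t ht
    refine le_antisymm ((hmono _ _ ht).trans ?_) (hnn t (by linarith))
    refine le_of_forall_pos_le_add fun ε hε => ?_
    have hl3 : 0 < Real.log 3 := Real.log_pos (by norm_num)
    obtain ⟨s, hs, hs'⟩ := exists_lt_of_lt_csSup hne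
      (show sSup {t | P t ≤ 0} - ε / Real.log 3 < sSup {t | P t ≤ 0} by
        have : 0 < ε / Real.log 3 := by positivity
        linarith)
    have h1 := hlip s _ (le_csSup hB hs)
    have h2 : (sSup {t | P t ≤ 0} - s) * Real.log 3 ≤ ε := by
      rw [← le_div_iff₀ hl3]
      linarith
    have hs0 : P s ≤ 0 := hs
    linarith
  · intro t ht
    by_contra! hc
    have := le_csSup hB (show t ∈ {t | P t ≤ 0} from hc)
    linarith
end

section
/- The families ((1+ij)^{−2.18})_{(i,j) ∈ ℕ≥1 × ℕ≥1} and ((1+ij)^{−2.17})_{(i,j) ∈ ℕ≥1 × ℕ≥1} are both summable, and ∑_{i,j=1}^∞ (1+ij)^{−2.18} < 1 < ∑_{i,j=1}^∞ (1+ij)^{−2.17}. -/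
/-- Bitwise search for the largest `k` (above `acc`) with `k ^ 100 * p ≤ B`. -/
def srch (B p : ℕ) : ℕ → ℕ → ℕ
  | 0, acc => acc
  | b + 1, acc =>
    cond (Nat.ble ((acc + 2 ^ b) ^ 100 * p) B) (srch B p b (acc + 2 ^ b)) (srch B p b acc)

def lo (B e n : ℕ) : ℕ := srch B (n ^ e) 31 0

def up (B C e n : ℕ) : ℕ :=
  cond (Nat.ble B ((lo B e n + 1) ^ 100 * n ^ e)) (lo B e n + 1) C

def sumTo (f : ℕ → ℕ) : ℕ → ℕ
  | 0 => 0
  | n + 1 => sumTo f n + f n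

theorem sumTo_eq (f : ℕ → ℕ) (n : ℕ) : sumTo f n = ∑ i ∈ Finset.range n, f i := by
  induction n with
  | zero => rfl
  | succ n ih => rw [Finset.sum_range_succ, sumTo, ih]

theorem srch_spec (B p b acc : ℕ) (h : acc ^ 100 * p ≤ B) :
    (srch B p b acc) ^ 100 * p ≤ B := by
  induction b generalizing acc with
  | zero => exact h
  | succ b ih =>
    rw [srch]
    cases hb : Nat.ble ((acc + 2 ^ b) ^ 100 * p) B with
    | true => exact ih _ (Nat.le_of_ble_eq_true hb)
    | false => exact ih _ h

theorem lo_spec (B n e : ℕ) : (lo B e n) ^ 100 * n ^ e ≤ B :=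
  srch_spec B _ 31 0 (by rw [zero_pow (by norm_num), zero_mul]; exact Nat.zero_le _)

theorem up_spec (B C n e : ℕ) (hB : B = C ^ 100) (hn : 1 ≤ n) : B ≤ (up B C e n) ^ 100 * n ^ e := by
  unfold up
  cases hb : Nat.ble B ((lo B e n + 1) ^ 100 * n ^ e) with
  | true => exact Nat.le_of_ble_eq_true hb
  | false =>
    rw [cond_false, ← hB]
    exact Nat.le_mul_of_pos_right _ (pow_pos hn e)

theorem rpow_hund (n e : ℕ) (t : ℝ) (ht : t * 100 = e) :
    (((n : ℝ) ^ (-t)) ^ 100) = ((n : ℝ) ^ e)⁻¹ := by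
  rw [← Real.rpow_natCast, ← Real.rpow_mul (Nat.cast_nonneg n)]
  have : -t * ((100 : ℕ) : ℝ) = -(e : ℝ) := by push_cast; linarith
  rw [this, Real.rpow_neg (Nat.cast_nonneg n), Real.rpow_natCast]

theorem lo_le (B C n e : ℕ) (hC : 0 < C) (hB : B = C ^ 100) (hn : 1 ≤ n) (t : ℝ)
    (ht : t * 100 = e) :
    (lo B e n : ℝ) / C ≤ (n : ℝ) ^ (-t) := by
  have hn' : (0 : ℝ) < n := by exact_mod_cast hn
  have hC' : (0 : ℝ) < C := by exact_mod_cast hC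
  refine le_of_pow_le_pow_left₀ (n := 100) (by norm_num) (Real.rpow_nonneg hn'.le _) ?_
  rw [rpow_hund n e t ht, div_pow, div_le_iff₀ (by positivity),
    inv_mul_eq_div, le_div_iff₀ (by positivity)]
  have := lo_spec B n e
  rw [hB] at this ⊢
  exact_mod_cast this

theorem le_up (B C n e : ℕ) (hC : 0 < C) (hB : B = C ^ 100) (hn : 1 ≤ n) (t : ℝ)
    (ht : t * 100 = e) :
    (n : ℝ) ^ (-t) ≤ (up B C e n : ℝ) / C := by
  have hn' : (0 : ℝ) < n := by exact_mod_cast hn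
  have hC' : (0 : ℝ) < C := by exact_mod_cast hC
  refine le_of_pow_le_pow_left₀ (n := 100) (by norm_num) (by positivity) ?_
  rw [rpow_hund n e t ht, div_pow, le_div_iff₀ (by positivity),
    inv_mul_eq_div, div_le_iff₀ (by positivity)]
  have := up_spec B C n e hB hn
  rw [hB] at this ⊢
  exact_mod_cast this

/-- The integer inequality behind the lower bound. -/
def CheckLo (B C N : ℕ) : Bool :=
  Nat.blt C (sumTo (fun i => sumTo (fun j => lo B 217 (1 + (i + 1) * (j + 1))) (N / (i + 1))) N)

/-- The integer inequality behind the upper bound. -/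
def CheckUp (B C M K : ℕ) : Bool :=
  Nat.blt ((118 * sumTo (fun i => up B C 218 (i + 1)) M + 100 * (M * up B C 218 M)) ^ 2
      + 118 ^ 2 * C * sumTo (fun i => sumTo (fun j => up B C 218 (1 + (i + 1) * (j + 1))) K) K)
      (118 ^ 2 * (C * C + C * sumTo (fun i => sumTo (fun j => lo B 218 ((i + 1) * (j + 1))) K) K))

theorem check_lo : CheckLo (2 ^ 3000) (2 ^ 30) 350 = true := by
  decide +kernel

theorem check_up : CheckUp (2 ^ 3000) (2 ^ 30) 50 12 = true := by
  decide +kernel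

theorem summ_a (t : ℝ) (ht : 1 < t) : Summable (fun i : ℕ => ((i + 1 : ℕ) : ℝ) ^ (-t)) :=
  (summable_nat_add_iff (f := fun i : ℕ => (i : ℝ) ^ (-t)) 1).2
    (Real.summable_nat_rpow.2 (by linarith))

theorem summ_aa (t : ℝ) (ht : 1 < t) : Summable (fun q : ℕ × ℕ =>
    ((q.1 + 1 : ℕ) : ℝ) ^ (-t) * ((q.2 + 1 : ℕ) : ℝ) ^ (-t)) :=
  (summ_a t ht).mul_of_nonneg (summ_a t ht) (fun i => by positivity) (fun i => by positivity)

theorem f_le (t : ℝ) (ht : 1 < t) (i j : ℕ) :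
    ((1 + (i + 1) * (j + 1) : ℕ) : ℝ) ^ (-t) ≤
      ((i + 1 : ℕ) : ℝ) ^ (-t) * ((j + 1 : ℕ) : ℝ) ^ (-t) := by
  rw [← Real.mul_rpow (by positivity) (by positivity)]
  refine Real.rpow_le_rpow_of_nonpos (by positivity) ?_ (by linarith)
  push_cast
  linarith

theorem summ_f (t : ℝ) (ht : 1 < t) : Summable (fun q : ℕ × ℕ =>
    ((1 + (q.1 + 1) * (q.2 + 1) : ℕ) : ℝ) ^ (-t)) :=
  Summable.of_nonneg_of_le (fun q => by positivity) (fun q => f_le t ht q.1 q.2) (summ_aa t ht)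

theorem lower_s19 (B C N : ℕ) (hC : 0 < C) (hB : B = C ^ 100) (h : CheckLo B C N = true) :
    1 < ∑' q : ℕ × ℕ, ((1 + (q.1 + 1) * (q.2 + 1) : ℕ) : ℝ) ^ (-2.17 : ℝ) := by
  have hs := summ_f 2.17 (by norm_num)
  have hC' : (0 : ℝ) < C := by exact_mod_cast hC
  have h1 := of_decide_eq_true (by simpa [CheckLo, Nat.blt_eq] using h :
    decide (C < sumTo (fun i => sumTo (fun j => lo B 217 (1 + (i + 1) * (j + 1))) (N / (i + 1))) N) = true)
  simp only [sumTo_eq] at h1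
  rw [hs.tsum_prod]
  have h2 : (1 : ℝ) < ∑ i ∈ Finset.range N, ∑ j ∈ Finset.range (N / (i + 1)),
      (lo B 217 (1 + (i + 1) * (j + 1)) : ℝ) / C := by
    simp only [← Finset.sum_div]
    rw [lt_div_iff₀ hC', one_mul]
    exact_mod_cast h1
  refine h2.trans_le ?_
  refine le_trans ?_ (hs.prod.sum_le_tsum (Finset.range N)
    (fun i _ => tsum_nonneg fun j => by positivity))
  refine Finset.sum_le_sum fun i _ => ?_
  refine le_trans ?_ ((hs.prod_factor i).sum_le_tsum (Finset.range (N / (i + 1)))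
    (fun j _ => by positivity))
  refine Finset.sum_le_sum fun j _ => ?_
  exact lo_le B C _ 217 hC hB (by omega) 2.17 (by norm_num)

theorem step (n : ℕ) (hn : 1 ≤ n) :
    ((n + 1 : ℕ) : ℝ) ^ (-2.18 : ℝ) + ((n + 1 : ℕ) : ℝ) ^ (-1.18 : ℝ) / 1.18 ≤
      (n : ℝ) ^ (-1.18 : ℝ) / 1.18 := by
  have hn' : (0 : ℝ) < n := by exact_mod_cast hn
  push_cast
  have hb := one_add_mul_self_le_rpow_one_add (s := 1 / (n : ℝ)) (p := 1.18)
    (by have : 0 < 1 / (n : ℝ) := by positivity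
        linarith) (by norm_num)
  have e1 : (1 : ℝ) + 1 / n = (n + 1) / n := by field_simp
  rw [e1, Real.div_rpow (by positivity) hn'.le, le_div_iff₀ (by positivity)] at hb
  have e2 : ((n : ℝ) + 1) ^ (-2.18 : ℝ) = ((n : ℝ) + 1) ^ (-1.18 : ℝ) / (n + 1) := by
    rw [show (-2.18 : ℝ) = -1.18 - 1 by norm_num, Real.rpow_sub_one (by positivity)]
  rw [e2, Real.rpow_neg (by positivity), Real.rpow_neg (by positivity)]
  have hx : 0 < (n : ℝ) ^ (1.18 : ℝ) := by positivity
  have hy : 0 < ((n : ℝ) + 1) ^ (1.18 : ℝ) := by positivity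
  generalize (n : ℝ) ^ (1.18 : ℝ) = x at *
  generalize ((n : ℝ) + 1) ^ (1.18 : ℝ) = y at *
  have h3 : 1 / ((n : ℝ) + 1) ≤ 1 / n := one_div_le_one_div_of_le hn' (by linarith)
  have h4 : (1 + 1.18 * (1 / ((n : ℝ) + 1))) * x ≤ y :=
    le_trans (mul_le_mul_of_nonneg_right (by linarith) hx.le) hb
  have h5 : (1 + 1.18 * (1 / ((n : ℝ) + 1))) / y ≤ 1 / x := by
    rw [div_le_div_iff₀ hy hx]; linarith
  have e3 : y⁻¹ / ((n : ℝ) + 1) + y⁻¹ / 1.18 = (1 + 1.18 * (1 / ((n : ℝ) + 1))) / y / 1.18 := by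
    field_simp
    ring
  rw [e3, ← one_div x]
  exact div_le_div_of_nonneg_right h5 (by norm_num)

theorem zeta_le (M : ℕ) (hM : 1 ≤ M) :
    ∑' i : ℕ, ((i + 1 : ℕ) : ℝ) ^ (-2.18 : ℝ) ≤
      ∑ i ∈ Finset.range M, ((i + 1 : ℕ) : ℝ) ^ (-2.18 : ℝ) + (M : ℝ) ^ (-1.18 : ℝ) / 1.18 := by
  have key : ∀ n, M ≤ n → ∑ i ∈ Finset.range n, ((i + 1 : ℕ) : ℝ) ^ (-2.18 : ℝ)
      + (n : ℝ) ^ (-1.18 : ℝ) / 1.18 ≤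
      ∑ i ∈ Finset.range M, ((i + 1 : ℕ) : ℝ) ^ (-2.18 : ℝ) + (M : ℝ) ^ (-1.18 : ℝ) / 1.18 := by
    intro n hn
    induction n, hn using Nat.le_induction with
    | base => exact le_rfl
    | succ n hn ih =>
      rw [Finset.sum_range_succ]
      have := step n (hM.trans hn)
      linarith
  refine Real.tsum_le_of_sum_range_le (fun i => by positivity) fun n => ?_
  have h1 := key (max M n) (le_max_left _ _)
  have h2 : ∑ i ∈ Finset.range n, ((i + 1 : ℕ) : ℝ) ^ (-2.18 : ℝ) ≤
      ∑ i ∈ Finset.range (max M n), ((i + 1 : ℕ) : ℝ) ^ (-2.18 : ℝ) :=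
    Finset.sum_le_sum_of_subset_of_nonneg (Finset.range_mono (le_max_right _ _))
      (fun i _ _ => by positivity)
  have h3 : 0 ≤ ((max M n : ℕ) : ℝ) ^ (-1.18 : ℝ) / 1.18 := by positivity
  linarith

theorem upper_s19 (B C M K : ℕ) (hC : 0 < C) (hB : B = C ^ 100) (hM : 1 ≤ M)
    (h : CheckUp B C M K = true) :
    ∑' q : ℕ × ℕ, ((1 + (q.1 + 1) * (q.2 + 1) : ℕ) : ℝ) ^ (-2.18 : ℝ) < 1 := by
  have hf := summ_f 2.18 (by norm_num)
  have haa := summ_aa 2.18 (by norm_num)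
  have ha := summ_a 2.18 (by norm_num)
  have hC' : (0 : ℝ) < C := by exact_mod_cast hC
  have hM' : (0 : ℝ) < M := by exact_mod_cast hM
  have h1 := h
  unfold CheckUp at h1
  rw [Nat.blt_eq] at h1
  simp only [sumTo_eq] at h1
  have hz := zeta_le M hM
  have hMs : (M : ℝ) ^ (-1.18 : ℝ) = M * (M : ℝ) ^ (-2.18 : ℝ) := by
    rw [show (-1.18 : ℝ) = 1 + -2.18 by norm_num, Real.rpow_add hM', Real.rpow_one]
  have hu1 : ∑ i ∈ Finset.range M, ((i + 1 : ℕ) : ℝ) ^ (-2.18 : ℝ) ≤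
      (∑ i ∈ Finset.range M, (up B C 218 (i + 1) : ℝ)) / C := by
    rw [Finset.sum_div]
    exact Finset.sum_le_sum fun i _ => le_up B C _ 218 hC hB (by omega) 2.18 (by norm_num)
  have hu2 : (M : ℝ) ^ (-2.18 : ℝ) ≤ (up B C 218 M : ℝ) / C :=
    le_up B C _ 218 hC hB hM 2.18 (by norm_num)
  have hsub := haa.tsum_sub hf
  have hprod : ∑' q : ℕ × ℕ, ((q.1 + 1 : ℕ) : ℝ) ^ (-2.18 : ℝ) * ((q.2 + 1 : ℕ) : ℝ) ^ (-2.18 : ℝ)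
      = (∑' i : ℕ, ((i + 1 : ℕ) : ℝ) ^ (-2.18 : ℝ)) ^ 2 := by
    rw [sq]
    exact (ha.tsum_mul_tsum ha haa).symm
  have hpart := (haa.sub hf).sum_le_tsum (Finset.range K ×ˢ Finset.range K)
    (fun q _ => sub_nonneg.2 (f_le 2.18 (by norm_num) q.1 q.2))
  have hlow : (∑ i ∈ Finset.range K, ∑ j ∈ Finset.range K, (lo B 218 ((i + 1) * (j + 1)) : ℝ)) / C
      - (∑ i ∈ Finset.range K, ∑ j ∈ Finset.range K,
          (up B C 218 (1 + (i + 1) * (j + 1)) : ℝ)) / C ≤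
      ∑ q ∈ Finset.range K ×ˢ Finset.range K,
      (((q.1 + 1 : ℕ) : ℝ) ^ (-2.18 : ℝ) * ((q.2 + 1 : ℕ) : ℝ) ^ (-2.18 : ℝ) -
        ((1 + (q.1 + 1) * (q.2 + 1) : ℕ) : ℝ) ^ (-2.18 : ℝ)) := by
    rw [Finset.sum_product]
    simp only [Finset.sum_div, ← Finset.sum_sub_distrib]
    refine Finset.sum_le_sum fun i _ => Finset.sum_le_sum fun j _ => sub_le_sub ?_ ?_
    · rw [← Real.mul_rpow (by positivity) (by positivity), ← Nat.cast_mul]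
      exact lo_le B C _ 218 hC hB (Nat.mul_pos i.succ_pos j.succ_pos) 2.18 (by norm_num)
    · exact le_up B C _ 218 hC hB (by omega) 2.18 (by norm_num)
  have h1' : ((118 * (∑ i ∈ Finset.range M, (up B C 218 (i + 1) : ℝ))
      + 100 * (M * (up B C 218 M : ℝ))) ^ 2
      + 118 ^ 2 * C * (∑ i ∈ Finset.range K, ∑ j ∈ Finset.range K,
          (up B C 218 (1 + (i + 1) * (j + 1)) : ℝ)) <
      118 ^ 2 * (C * C + C * (∑ i ∈ Finset.range K, ∑ j ∈ Finset.range K,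
        (lo B 218 ((i + 1) * (j + 1)) : ℝ)))) := by
    exact_mod_cast h1
  have hz0 : 0 ≤ ∑' i : ℕ, ((i + 1 : ℕ) : ℝ) ^ (-2.18 : ℝ) := tsum_nonneg fun i => by positivity
  rw [hprod] at hsub
  rw [hsub] at hpart
  have hcomb := hlow.trans hpart
  clear hlow hpart hsub hprod h1 h
  rw [hMs] at hz
  generalize (∑' i : ℕ, ((i + 1 : ℕ) : ℝ) ^ (-2.18 : ℝ)) = Z at *
  generalize (∑ i ∈ Finset.range M, (up B C 218 (i + 1) : ℝ)) = U at *
  generalize (∑ i ∈ Finset.range M, ((i + 1 : ℕ) : ℝ) ^ (-2.18 : ℝ)) = Y at *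
  generalize (up B C 218 M : ℝ) = V at *
  generalize (∑ i ∈ Finset.range K, ∑ j ∈ Finset.range K,
          (up B C 218 (1 + (i + 1) * (j + 1)) : ℝ)) = P at *
  generalize (∑ i ∈ Finset.range K, ∑ j ∈ Finset.range K,
        (lo B 218 ((i + 1) * (j + 1)) : ℝ)) = L at *
  have hZ : Z ≤ (118 * U + 100 * (M * V)) / (118 * C) := by
    have : (M : ℝ) * (M : ℝ) ^ (-2.18 : ℝ) ≤ M * (V / C) := mul_le_mul_of_nonneg_left hu2 hM'.le
    have e : (118 * U + 100 * (M * V)) / (118 * C) = U / C + M * (V / C) / 1.18 := by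
      field_simp
      ring
    rw [e]
    linarith [div_le_div_of_nonneg_right this (by norm_num : (0 : ℝ) ≤ 1.18)]
  have hZ2 := pow_le_pow_left₀ hz0 hZ 2
  have hfin : ((118 * U + 100 * (M * V)) / (118 * C)) ^ 2 + P / C < 1 + L / C := by
    have e1 : ((118 * U + 100 * (M * V)) / (118 * C)) ^ 2 + P / C =
        ((118 * U + 100 * (M * V)) ^ 2 + 118 ^ 2 * C * P) / (118 ^ 2 * (C * C)) := by
      field_simp
    have e2 : 1 + L / C = 118 ^ 2 * (C * C + C * L) / (118 ^ 2 * (C * C)) := by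
      field_simp
    rw [e1, e2]
    exact div_lt_div_of_pos_right h1' (by positivity)
  linarith

theorem transfer (t : ℝ) (q : ℕ+ × ℕ+) :
    (1 + (q.1 : ℝ) * (q.2 : ℝ)) ^ t = (fun q : ℕ × ℕ =>
      ((1 + (q.1 + 1) * (q.2 + 1) : ℕ) : ℝ) ^ t)
      (Equiv.prodCongr Equiv.pnatEquivNat Equiv.pnatEquivNat q) := by
  have h : ∀ n : ℕ+, Equiv.pnatEquivNat n + 1 = (n : ℕ) := fun n => PNat.natPred_add_one n
  simp only [Equiv.prodCongr_apply, Prod.map_fst, Prod.map_snd, h]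
  push_cast
  rfl

theorem hBC : (2 ^ 3000 : ℕ) = (2 ^ 30) ^ 100 := by rw [← pow_mul]

/-- The families `((1 + i j) ^ (-2.18))_{i,j ≥ 1}` and
`((1 + i j) ^ (-2.17))_{i,j ≥ 1}` are both summable, and
`∑_{i,j} (1 + i j) ^ (-2.18) < 1 < ∑_{i,j} (1 + i j) ^ (-2.17)`. -/
theorem stmt19 :
    Summable (fun q : ℕ+ × ℕ+ => (1 + (q.1 : ℝ) * (q.2 : ℝ)) ^ (-2.18 : ℝ)) ∧
    Summable (fun q : ℕ+ × ℕ+ => (1 + (q.1 : ℝ) * (q.2 : ℝ)) ^ (-2.17 : ℝ)) ∧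
    ∑' q : ℕ+ × ℕ+, (1 + (q.1 : ℝ) * (q.2 : ℝ)) ^ (-2.18 : ℝ) < 1 ∧
    1 < ∑' q : ℕ+ × ℕ+, (1 + (q.1 : ℝ) * (q.2 : ℝ)) ^ (-2.17 : ℝ) := by
  simp only [transfer]
  refine ⟨?_, ?_, ?_, ?_⟩
  · exact (Equiv.summable_iff (Equiv.prodCongr Equiv.pnatEquivNat Equiv.pnatEquivNat)).2
      (summ_f 2.18 (by norm_num))
  · exact (Equiv.summable_iff (Equiv.prodCongr Equiv.pnatEquivNat Equiv.pnatEquivNat)).2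
      (summ_f 2.17 (by norm_num))
  · rw [Equiv.tsum_eq (Equiv.prodCongr Equiv.pnatEquivNat Equiv.pnatEquivNat)
      (fun q : ℕ × ℕ => ((1 + (q.1 + 1) * (q.2 + 1) : ℕ) : ℝ) ^ (-2.18 : ℝ))]
    exact upper_s19 _ _ _ _ (by norm_num) hBC (by norm_num) check_up
  · rw [Equiv.tsum_eq (Equiv.prodCongr Equiv.pnatEquivNat Equiv.pnatEquivNat)
      (fun q : ℕ × ℕ => ((1 + (q.1 + 1) * (q.2 + 1) : ℕ) : ℝ) ^ (-2.17 : ℝ))]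
    exact lower_s19 _ _ _ (by norm_num) hBC check_lo
end
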